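/- Fix c₁, c₂ ∈ ℝ. Then lim_{σ → -1⁺} ℓ(c₁, c₂; σ) equals 1 - Φ(c₁) - Φ(c₂) if c₁ + c₂ ≤ 0, and equals 0 if c₁ + c₂ > 0. -/

import Mathlib

open MeasureTheory Real Filter

/-- The standard normal probability density function. -/
noncomputable def stdPdf (x : ℝ) : ℝ := (Real.sqrt (2 * Real.pi))⁻¹ * Real.exp (-(x ^ 2) / 2)

/-- The standard normal cumulative distribution function. -/
noncomputable def stdCdf (x : ℝ) : ℝ := ∫ t in Set.Iic x, stdPdf t

/-- The upper bivariate normal tail probability for correlation `σ ∈ (-1,1)`. -/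
noncomputable def biTail (c₁ c₂ σ : ℝ) : ℝ :=
  (2 * Real.pi * Real.sqrt (1 - σ ^ 2))⁻¹ *
    ∫ x in Set.Ioi c₁, ∫ y in Set.Ioi c₂,
      Real.exp (-(x ^ 2 + y ^ 2 - 2 * σ * x * y) / (2 * (1 - σ ^ 2)))

lemma stdPdf_eq_gaussianPDFReal (x : ℝ) :
    stdPdf x = ProbabilityTheory.gaussianPDFReal 0 1 x := by
  simp [stdPdf, ProbabilityTheory.gaussianPDFReal_def]

lemma stdPdf_nonneg (x : ℝ) : 0 ≤ stdPdf x := by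
  unfold stdPdf
  positivity

lemma integrable_stdPdf : Integrable stdPdf := by
  rw [funext stdPdf_eq_gaussianPDFReal]
  exact ProbabilityTheory.integrable_gaussianPDFReal 0 1

lemma integral_stdPdf : ∫ x, stdPdf x = 1 := by
  rw [funext stdPdf_eq_gaussianPDFReal]
  exact ProbabilityTheory.integral_gaussianPDFReal_eq_one 0 one_ne_zero

lemma stdCdf_eq_cdf :
    stdCdf = ProbabilityTheory.cdf (ProbabilityTheory.gaussianReal 0 1) := by
  funext x
  rw [ProbabilityTheory.cdf_eq_real, measureReal_def,
    ProbabilityTheory.gaussianReal_apply_eq_integral 0 one_ne_zero,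
    ← funext stdPdf_eq_gaussianPDFReal,
    ENNReal.toReal_ofReal (integral_nonneg stdPdf_nonneg), stdCdf]

lemma measurable_stdCdf : Measurable stdCdf := by
  rw [stdCdf_eq_cdf]
  exact (ProbabilityTheory.monotone_cdf _).measurable

lemma stdCdf_nonneg (x : ℝ) : 0 ≤ stdCdf x := by
  rw [stdCdf_eq_cdf]
  exact ProbabilityTheory.cdf_nonneg _ x

lemma stdCdf_le_one (x : ℝ) : stdCdf x ≤ 1 := by
  rw [stdCdf_eq_cdf]
  exact ProbabilityTheory.cdf_le_one _ x

lemma tendsto_stdCdf_atTop : Tendsto stdCdf atTop (nhds 1) := by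
  rw [stdCdf_eq_cdf]
  exact ProbabilityTheory.tendsto_cdf_atTop _

lemma tendsto_stdCdf_atBot : Tendsto stdCdf atBot (nhds 0) := by
  rw [stdCdf_eq_cdf]
  exact ProbabilityTheory.tendsto_cdf_atBot _

lemma integral_Ioi_stdPdf (a : ℝ) : ∫ x in Set.Ioi a, stdPdf x = stdCdf (-a) := by
  have h := integral_comp_neg_Ioi a stdPdf
  simpa [stdPdf, stdCdf] using h

lemma stdCdf_neg (a : ℝ) : stdCdf (-a) = 1 - stdCdf a := by
  have h := intervalIntegral.integral_Iic_add_Ioi (b := a) (f := stdPdf) (μ := volume)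
    integrable_stdPdf.integrableOn integrable_stdPdf.integrableOn
  rw [integral_stdPdf, integral_Ioi_stdPdf] at h
  unfold stdCdf at h ⊢
  linarith

lemma integral_Ioi_comp_sub_div (f : ℝ → ℝ) (c m : ℝ) {s : ℝ} (hs : 0 < s) :
    ∫ y in Set.Ioi c, f ((y - m) / s) = s * ∫ t in Set.Ioi ((c - m) / s), f t := by
  have h : ∀ y, (Set.Ioi c).indicator (fun y => f ((y - m) / s)) y =
      (Set.Ioi ((c - m) / s)).indicator f ((y - m) / s) := by
    intro y
    have : (c - m) / s < (y - m) / s ↔ c < y := by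
      rw [div_lt_div_iff_of_pos_right hs, sub_lt_sub_iff_right]
    simp only [Set.indicator, Set.mem_Ioi, this]
  rw [← integral_indicator measurableSet_Ioi, ← integral_indicator measurableSet_Ioi,
    integral_congr_ae (Eventually.of_forall h),
    integral_sub_right_eq_self (fun y => (Set.Ioi ((c - m) / s)).indicator f (y / s)) m,
    Measure.integral_comp_div, abs_of_pos hs, smul_eq_mul]

/-- Conditioning on the first coordinate writes the tail as a single integral. -/
lemma biTail_eq_integral (c₁ c₂ : ℝ) {σ : ℝ} (hσ : 0 < 1 - σ ^ 2) :
    biTail c₁ c₂ σ =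
      ∫ x in Set.Ioi c₁, stdPdf x * stdCdf ((σ * x - c₂) / √(1 - σ ^ 2)) := by
  have hs : 0 < √(1 - σ ^ 2) := Real.sqrt_pos.2 hσ
  have hpi : √(2 * Real.pi) * √(2 * Real.pi) = 2 * Real.pi := Real.mul_self_sqrt (by positivity)
  have hpos : 0 < √(2 * Real.pi) := by positivity
  have h : ∀ x y : ℝ, Real.exp (-(x ^ 2 + y ^ 2 - 2 * σ * x * y) / (2 * (1 - σ ^ 2))) =
      2 * Real.pi * stdPdf x * stdPdf ((y - σ * x) / √(1 - σ ^ 2)) := by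
    intro x y
    have he : -(x ^ 2 + y ^ 2 - 2 * σ * x * y) / (2 * (1 - σ ^ 2)) =
        -(x ^ 2) / 2 + -(((y - σ * x) / √(1 - σ ^ 2)) ^ 2) / 2 := by
      rw [div_pow, Real.sq_sqrt hσ.le]
      field_simp
      ring
    rw [he, Real.exp_add, stdPdf, stdPdf]
    field_simp
    rw [pow_two, hpi]
  have hinner : ∀ x : ℝ, ∫ y in Set.Ioi c₂,
      Real.exp (-(x ^ 2 + y ^ 2 - 2 * σ * x * y) / (2 * (1 - σ ^ 2))) =
      2 * Real.pi * √(1 - σ ^ 2) * (stdPdf x * stdCdf ((σ * x - c₂) / √(1 - σ ^ 2))) := by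
    intro x
    simp_rw [h x]
    rw [integral_const_mul, integral_Ioi_comp_sub_div _ _ _ hs, integral_Ioi_stdPdf,
      ← neg_div, neg_sub]
    ring
  rw [biTail]
  simp_rw [hinner]
  rw [integral_const_mul, ← mul_assoc, inv_mul_cancel₀ (by positivity), one_mul]

lemma tendsto_inv_sqrt_one_sub_sq :
    Tendsto (fun σ : ℝ => (√(1 - σ ^ 2))⁻¹) (nhdsWithin (-1) (Set.Ioo (-1) 1)) atTop := by
  refine tendsto_inv_nhdsGT_zero.comp (tendsto_nhdsWithin_iff.2 ⟨?_, ?_⟩)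
  · have h : Continuous fun σ : ℝ => √(1 - σ ^ 2) := by fun_prop
    simpa using (h.tendsto (-1)).mono_left nhdsWithin_le_nhds
  · filter_upwards [self_mem_nhdsWithin] with σ hσ
    exact Real.sqrt_pos.2 (by nlinarith [hσ.1, hσ.2])

lemma tendsto_stdCdf_conditional (c x : ℝ) (hx : x ≠ -c) :
    Tendsto (fun σ : ℝ => stdCdf ((σ * x - c) / √(1 - σ ^ 2)))
      (nhdsWithin (-1) (Set.Ioo (-1) 1)) (nhds (if x ≤ -c then 1 else 0)) := by
  have hnum : Tendsto (fun σ : ℝ => σ * x - c) (nhdsWithin (-1) (Set.Ioo (-1) 1))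
      (nhds (-1 * x - c)) :=
    ((by fun_prop : Continuous fun σ : ℝ => σ * x - c).tendsto (-1)).mono_left
      nhdsWithin_le_nhds
  simp_rw [div_eq_mul_inv]
  rcases hx.lt_or_gt with h | h
  · rw [if_pos h.le]
    exact tendsto_stdCdf_atTop.comp
      (hnum.pos_mul_atTop (by linarith) tendsto_inv_sqrt_one_sub_sq)
  · rw [if_neg h.not_ge]
    exact tendsto_stdCdf_atBot.comp
      (hnum.neg_mul_atTop (by linarith) tendsto_inv_sqrt_one_sub_sq)

lemma integral_Ioi_stdPdf_truncated (c₁ c₂ : ℝ) :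
    ∫ x in Set.Ioi c₁, stdPdf x * (if x ≤ -c₂ then (1 : ℝ) else 0) =
      if c₁ + c₂ ≤ 0 then 1 - stdCdf c₁ - stdCdf c₂ else 0 := by
  have h : (fun x => stdPdf x * (if x ≤ -c₂ then (1 : ℝ) else 0)) =
      (Set.Iic (-c₂)).indicator stdPdf := by
    funext x
    simp [Set.indicator]
  rw [h, setIntegral_indicator measurableSet_Iic, Set.Ioi_inter_Iic]
  split_ifs with hc
  · rw [← intervalIntegral.integral_of_le (by linarith),
      ← intervalIntegral.integral_Iic_sub_Iic integrable_stdPdf.integrableOn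
        integrable_stdPdf.integrableOn]
    have := stdCdf_neg c₂
    unfold stdCdf at this ⊢
    linarith
  · rw [Set.Ioc_eq_empty (by linarith), setIntegral_empty]

/-- `lim_{σ → -1⁺} ℓ(c₁, c₂; σ)` equals `1 - Φ(c₁) - Φ(c₂)` if `c₁ + c₂ ≤ 0`
and equals `0` if `c₁ + c₂ > 0`. -/
theorem biTail_tendsto_neg_one (c₁ c₂ : ℝ) :
    Tendsto (fun σ => biTail c₁ c₂ σ) (nhdsWithin (-1) (Set.Ioi (-1)))
      (nhds (if c₁ + c₂ ≤ 0 then 1 - stdCdf c₁ - stdCdf c₂ else 0)) := by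
  rw [← nhdsWithin_Ioo_eq_nhdsGT (by norm_num : (-1 : ℝ) < 1),
    ← integral_Ioi_stdPdf_truncated]
  have heq : (fun σ => ∫ x in Set.Ioi c₁, stdPdf x * stdCdf ((σ * x - c₂) / √(1 - σ ^ 2)))
      =ᶠ[nhdsWithin (-1) (Set.Ioo (-1) 1)] fun σ => biTail c₁ c₂ σ := by
    filter_upwards [self_mem_nhdsWithin] with σ hσ
    exact (biTail_eq_integral c₁ c₂ (by nlinarith [hσ.1, hσ.2])).symm
  refine Tendsto.congr' heq (tendsto_integral_filter_of_dominated_convergence stdPdf ?_ ?_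
    integrable_stdPdf.integrableOn ?_)
  · refine Eventually.of_forall fun σ => ?_
    exact integrable_stdPdf.aestronglyMeasurable.restrict.mul
      (measurable_stdCdf.comp (by fun_prop)).aestronglyMeasurable
  · refine Eventually.of_forall fun σ => Eventually.of_forall fun x => ?_
    rw [Real.norm_of_nonneg (mul_nonneg (stdPdf_nonneg _) (stdCdf_nonneg _))]
    exact mul_le_of_le_one_right (stdPdf_nonneg _) (stdCdf_le_one _)
  · filter_upwards [Measure.ae_ne (volume.restrict (Set.Ioi c₁)) (-c₂)] with x hx
    exact (tendsto_stdCdf_conditional c₂ x hx).const_mul _
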